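/- Let k be a commutative ring and A a classical commutative smooth k-algebra of finite type. Then the cotangent complex-style kernel I of the multiplication map A ⊗_k A → A is a compact (perfect) object of the derived category of A ⊗_k A-modules, and consequently A is compact as an A ⊗_k A-module. -/

import Mathlib

/-!
STATEMENT 14: Let `k` be a commutative ring and `A` a classical commutative smooth
`k`-algebra of finite type.  Then the kernel `I` of the multiplication map
`A ⊗_k A → A` is a compact (perfect) object of the derived category of `A ⊗_k A`-modules,
and consequently `A` is compact (perfect) as an `A ⊗_k A`-module.

Per the context, "compact" in `D(A ⊗_k A)` means that derived Hom commutes with arbitrary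
direct sums, equivalently that the module is perfect; we formalize perfectness of a module as
the existence of a finite-length resolution by finitely generated projective modules.
-/

open CategoryTheory CategoryTheory.Limits TensorProduct

universe u

namespace Stmt14

/-- A module `M` over `S` is perfect if it admits a finite-length resolution by finitely
generated projective `S`-modules, i.e. there is a bounded complex of finitely generated
projectives together with a quasi-isomorphism to `M` (placed in degree `0`). -/
def IsPerfectModule (S : Type u) [Ring S] (M : ModuleCat.{u} S) : Prop :=
  ∃ (P : ChainComplex (ModuleCat.{u} S) ℕ)
    (φ : P ⟶ (HomologicalComplex.single (ModuleCat.{u} S) (ComplexShape.down ℕ) 0).obj M),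
    (∀ i, Module.Finite S (P.X i)) ∧ (∀ i, Module.Projective S (P.X i)) ∧
      (∃ n : ℕ, ∀ i, n ≤ i → IsZero (P.X i)) ∧ QuasiIso φ

variable (k A : Type u) [CommRing k] [CommRing A] [Algebra k A]

/-- The multiplication map `A ⊗[k] A →ₐ[k] A`. -/
noncomputable def mulMap : (A ⊗[k] A) →ₐ[k] A :=
  Algebra.TensorProduct.lift (AlgHom.id k A) (AlgHom.id k A) fun _ _ => Commute.all _ _

/-- `HasFiniteResolution S n M`: the `S`-module `M` admits a resolution of length at most `n` by
finitely generated projective modules. -/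
inductive HasFiniteResolution (S : Type u) [CommRing S] :
    ℕ → ∀ (M : Type u) [AddCommGroup M] [Module S M], Prop
  | zero (M : Type u) [AddCommGroup M] [Module S M] [Module.Finite S M] [Module.Projective S M] :
      HasFiniteResolution S 0 M
  | succ {n : ℕ} {K F M : Type u} [AddCommGroup K] [Module S K] [AddCommGroup F] [Module S F]
      [AddCommGroup M] [Module S M] [Module.Finite S F] [Module.Projective S F]
      (i : K →ₗ[S] F) (p : F →ₗ[S] M) (hi : Function.Injective i) (hp : Function.Surjective p)
      (hip : Function.Exact i p) (hK : HasFiniteResolution S n K) :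
      HasFiniteResolution S (n + 1) M

namespace HasFiniteResolution

variable {S : Type u} [CommRing S] {n : ℕ} {K L M N F : Type u}
  [AddCommGroup K] [Module S K] [AddCommGroup L] [Module S L] [AddCommGroup M] [Module S M]
  [AddCommGroup N] [Module S N] [AddCommGroup F] [Module S F]

lemma finite_projective (h : HasFiniteResolution S 0 M) :
    Module.Finite S M ∧ Module.Projective S M := by
  cases h; exact ⟨‹_›, ‹_›⟩

lemma finite (h : HasFiniteResolution S n M) : Module.Finite S M := by
  cases h with
  | zero => infer_instance
  | succ i p hi hp => exact Module.Finite.of_surjective p hp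

lemma of_equiv (h : HasFiniteResolution S n M) (e : M ≃ₗ[S] N) : HasFiniteResolution S n N := by
  cases h with
  | zero =>
    have := Module.Finite.equiv e
    have := Module.Projective.of_equiv e
    exact zero N
  | succ i p hi hp hip hK =>
    refine succ i (e.toLinearMap ∘ₗ p) hi (e.surjective.comp hp) (fun x ↦ ?_) hK
    simpa using hip x

lemma of_subsingleton [Subsingleton M] : ∀ n, HasFiniteResolution S n M
  | 0 => zero M
  | n + 1 => succ (0 : M →ₗ[S] M) (0 : M →ₗ[S] M) (Function.injective_of_subsingleton _)
      (Function.surjective_to_subsingleton _)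
      (fun _ ↦ ⟨fun _ ↦ ⟨0, Subsingleton.elim _ _⟩, fun _ ↦ rfl⟩) (of_subsingleton n)

lemma of_projective [Module.Finite S M] [Module.Projective S M] : ∀ n, HasFiniteResolution S n M
  | 0 => zero M
  | n + 1 => succ (0 : PUnit.{u + 1} →ₗ[S] M) (LinearMap.id : M →ₗ[S] M)
      (Function.injective_of_subsingleton _) Function.surjective_id
      (fun x ↦ by simp [eq_comm]) (of_subsingleton n)

lemma succ_of (h : HasFiniteResolution S n M) : HasFiniteResolution S (n + 1) M := by
  induction h with
  | zero M => exact of_projective 1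
  | succ i p hi hp hip hK ih => exact succ i p hi hp hip ih

lemma mono {m : ℕ} (h : HasFiniteResolution S n M) (hnm : n ≤ m) : HasFiniteResolution S m M := by
  induction hnm with
  | refl => exact h
  | step _ ih => exact ih.succ_of

lemma prodEquiv_of_projective [Module.Projective S F] {i : K →ₗ[S] M} {p : M →ₗ[S] F}
    (hi : Function.Injective i) (hp : Function.Surjective p) (hip : Function.Exact i p) :
    Nonempty (M ≃ₗ[S] K × F) := by
  obtain ⟨s, hs⟩ := Module.projective_lifting_property p LinearMap.id hp
  exact ⟨(hip.splitSurjectiveEquiv hi ⟨s, hs⟩).1⟩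

/-- The kernel of a surjection onto a finitely generated projective module. -/
lemma of_surjective_projective [Module.Finite S F] [Module.Projective S F]
    (h : HasFiniteResolution S n M) {i : K →ₗ[S] M} {p : M →ₗ[S] F}
    (hi : Function.Injective i) (hp : Function.Surjective p) (hip : Function.Exact i p) :
    HasFiniteResolution S n K := by
  obtain ⟨e⟩ := prodEquiv_of_projective hi hp hip
  cases h with
  | zero =>
    have := Module.Finite.of_surjective (LinearMap.fst S K F ∘ₗ e.toLinearMap)
      (Prod.fst_surjective.comp e.surjective)
    have := Module.Projective.of_split (e.symm.toLinearMap ∘ₗ LinearMap.inl S K F)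
      (LinearMap.fst S K F ∘ₗ e.toLinearMap) (by ext; simp)
    exact zero K
  | @succ n L G _ _ _ _ _ _ _ _ _ j q hj hq hjq hL =>
    let r := LinearMap.snd S K F ∘ₗ e.toLinearMap ∘ₗ q
    have hr : Function.Surjective r := Prod.snd_surjective.comp (e.surjective.comp hq)
    obtain ⟨e'⟩ := prodEquiv_of_projective r.ker.injective_subtype hr
      (LinearMap.exact_subtype_ker_map r)
    have := Module.Finite.of_surjective (LinearMap.fst S _ F ∘ₗ e'.toLinearMap)
      (Prod.fst_surjective.comp e'.surjective)
    have := Module.Projective.of_split (e'.symm.toLinearMap ∘ₗ LinearMap.inl S r.ker F)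
      (LinearMap.fst S _ F ∘ₗ e'.toLinearMap) (by ext; simp)
    refine succ (F := r.ker) (j.codRestrict _ fun x ↦ ?_)
      (LinearMap.fst S K F ∘ₗ e.toLinearMap ∘ₗ q ∘ₗ r.ker.subtype)
      (fun x y h ↦ hj congr(($h).1)) ?_ ?_ hL
    · simp [r, hjq.apply_apply_eq_zero]
    · intro k
      obtain ⟨g, hg⟩ := hq (e.symm (k, 0))
      exact ⟨⟨g, by simp [r, hg]⟩, by simp [hg]⟩
    · rintro ⟨x, hx⟩
      have : (e (q x)).2 = 0 := hx
      have h0 : (e (q x)).1 = 0 ↔ q x = 0 := by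
        rw [← e.map_eq_zero_iff, Prod.ext_iff]; simp [this]
      simp [h0, hjq x, Subtype.ext_iff]

/-- Horseshoe lemma. -/
lemma of_extension (hK : HasFiniteResolution S n K) (hN : HasFiniteResolution S n N)
    {i : K →ₗ[S] M} {p : M →ₗ[S] N}
    (hi : Function.Injective i) (hp : Function.Surjective p) (hip : Function.Exact i p) :
    HasFiniteResolution S n M := by
  induction n generalizing K M N with
  | zero =>
    obtain ⟨_, _⟩ := hK.finite_projective
    obtain ⟨_, _⟩ := hN.finite_projective
    obtain ⟨e⟩ := prodEquiv_of_projective hi hp hip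
    exact (zero (K × N)).of_equiv e.symm
  | succ n ih =>
    cases hK with | @succ _ K' F' _ _ _ _ _ _ _ _ _ i' p' hi' hp' hip' hK' =>
    cases hN with | @succ _ K'' F'' _ _ _ _ _ _ _ _ _ i'' p'' hi'' hp'' hip'' hK'' =>
    obtain ⟨s, hs⟩ := Module.projective_lifting_property p p'' hp
    replace hs (x) : p (s x) = p'' x := congr($hs x)
    let q : F' × F'' →ₗ[S] M := (i ∘ₗ p').coprod s
    have hq : Function.Surjective q := by
      intro m
      obtain ⟨y, hy⟩ := hp'' (p m)
      obtain ⟨k, hk⟩ := (hip (m - s y)).1 (by simp [hs, hy])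
      obtain ⟨x, rfl⟩ := hp' k
      exact ⟨(x, y), by simp [q, hk]⟩
    refine succ q.ker.subtype q q.ker.injective_subtype hq (LinearMap.exact_subtype_ker_map q) ?_
    have hker (z : q.ker) : i (p' z.1.1) + s z.1.2 = 0 := z.2
    have h2 (z : q.ker) : p'' z.1.2 = 0 := by
      simpa [hs, hip.apply_apply_eq_zero] using congr(p $(hker z))
    let e'' : K'' ≃ₗ[S] p''.ker :=
      LinearEquiv.ofInjective i'' hi'' ≪≫ₗ LinearEquiv.ofEq _ _ hip''.linearMap_ker_eq.symm
    refine ih hK' (hK''.of_equiv e'')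
      (i := (LinearMap.inl S F' F'' ∘ₗ i').codRestrict _
        fun x ↦ by simp [q, hip'.apply_apply_eq_zero])
      (p := (LinearMap.snd S F' F'' ∘ₗ q.ker.subtype).codRestrict _ h2)
      (fun x y h ↦ hi' congr(($h).1.1)) ?_ ?_
    · rintro ⟨y, hy⟩
      obtain ⟨k, hk⟩ := (hip (s y)).1 (by rw [hs]; exact hy)
      obtain ⟨x, rfl⟩ := hp' k
      exact ⟨⟨(-x, y), by simp [q, hk]⟩, rfl⟩
    · rintro ⟨⟨x, y⟩, hz⟩
      have hz' : i (p' x) + s y = 0 := hz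
      constructor
      · intro h
        obtain rfl : y = 0 := congr(($h).1)
        obtain ⟨w, rfl⟩ := (hip' x).1 (hi (by simpa using hz'))
        exact ⟨w, rfl⟩
      · rintro ⟨w, hw⟩
        exact Subtype.ext congr(($hw).1.2).symm

lemma prod (hM : HasFiniteResolution S n M) (hN : HasFiniteResolution S n N) :
    HasFiniteResolution S n (M × N) :=
  of_extension hM hN LinearMap.inl_injective LinearMap.snd_surjective .inl_snd

/-- Schanuel's lemma: any syzygy of a module with a resolution of length `n + 1` has a resolution
of length `n`. -/
lemma syzygy [Module.Finite S F] [Module.Projective S F]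
    (h : HasFiniteResolution S (n + 1) M) {i : K →ₗ[S] F} {p : F →ₗ[S] M}
    (hi : Function.Injective i) (hp : Function.Surjective p) (hip : Function.Exact i p) :
    HasFiniteResolution S n K := by
  cases h with | @succ _ L G _ _ _ _ _ _ _ _ _ j q hj hq hjq hL =>
  let d : F × G →ₗ[S] M := p.coprod (-q)
  have hd (z : d.ker) : p z.1.1 = q z.1.2 := by
    have h : p z.1.1 + -q z.1.2 = 0 := z.2
    rwa [← sub_eq_add_neg, sub_eq_zero] at h
  have hP : HasFiniteResolution S n d.ker := by
    refine of_extension hL (of_projective n : HasFiniteResolution S n F)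
      (i := (LinearMap.inr S F G ∘ₗ j).codRestrict _
        fun x ↦ by simp [d, hjq.apply_apply_eq_zero])
      (p := LinearMap.fst S F G ∘ₗ d.ker.subtype) (fun x y h ↦ hj congr(($h).1.2)) ?_ ?_
    · intro x
      obtain ⟨y, hy⟩ := hq (p x)
      exact ⟨⟨(x, y), by simp [d, hy]⟩, rfl⟩
    · rintro ⟨⟨x, y⟩, hz⟩
      have hz' := hd ⟨(x, y), hz⟩
      constructor
      · intro h
        obtain rfl : x = 0 := h
        obtain ⟨w, rfl⟩ := (hjq y).1 (by simpa using hz'.symm)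
        exact ⟨w, rfl⟩
      · rintro ⟨w, hw⟩
        exact congr(($hw).1.1).symm
  refine hP.of_surjective_projective (F := G)
    (i := (LinearMap.inl S F G ∘ₗ i).codRestrict _
      fun x ↦ by simp [d, hip.apply_apply_eq_zero])
    (p := LinearMap.snd S F G ∘ₗ d.ker.subtype) (fun x y h ↦ hi congr(($h).1.1)) ?_ ?_
  · intro y
    obtain ⟨x, hx⟩ := hp (q y)
    exact ⟨⟨(x, y), by simp [d, hx]⟩, rfl⟩
  · rintro ⟨⟨x, y⟩, hz⟩
    have hz' := hd ⟨(x, y), hz⟩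
    constructor
    · intro h
      obtain rfl : y = 0 := h
      obtain ⟨w, rfl⟩ := (hip x).1 (by simpa using hz')
      exact ⟨w, rfl⟩
    · rintro ⟨w, hw⟩
      exact congr(($hw).1.2).symm

/-- The cokernel of an injection between modules with finite resolutions. -/
lemma of_injective (hK : HasFiniteResolution S n K) (hM : HasFiniteResolution S n M)
    {i : K →ₗ[S] M} {p : M →ₗ[S] N}
    (hi : Function.Injective i) (hp : Function.Surjective p) (hip : Function.Exact i p) :
    HasFiniteResolution S (n + 1) N := by
  cases hM with
  | zero => exact succ i p hi hp hip hK
  | @succ n L F _ _ _ _ _ _ _ _ _ j q hj hq hjq hL =>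
    let r := p ∘ₗ q
    refine succ r.ker.subtype r r.ker.injective_subtype (hp.comp hq)
      (LinearMap.exact_subtype_ker_map r) ?_
    let e : K ≃ₗ[S] p.ker :=
      LinearEquiv.ofInjective i hi ≪≫ₗ LinearEquiv.ofEq _ _ hip.linearMap_ker_eq.symm
    refine of_extension hL.succ_of (hK.of_equiv e)
      (i := j.codRestrict _ fun x ↦ by simp [r, hjq.apply_apply_eq_zero])
      (p := (q ∘ₗ r.ker.subtype).codRestrict _ fun x ↦ x.2) (fun x y h ↦ hj congr(($h).1)) ?_ ?_
    · rintro ⟨m, hm⟩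
      obtain ⟨x, rfl⟩ := hq m
      exact ⟨⟨x, hm⟩, rfl⟩
    · rintro ⟨x, hx⟩
      constructor
      · intro h
        obtain ⟨w, rfl⟩ := (hjq x).1 congr(($h).1)
        exact ⟨w, rfl⟩
      · rintro ⟨w, hw⟩
        exact Subtype.ext ((hjq x).2 ⟨w, congr(($hw).1)⟩)

/-- A direct summand of a module with a finite resolution. -/
lemma of_prod (h : HasFiniteResolution S n (M × N)) : HasFiniteResolution S n M := by
  induction n generalizing M N with
  | zero =>
    obtain ⟨_, _⟩ := h.finite_projective
    have := Module.Finite.of_surjective (LinearMap.fst S M N) Prod.fst_surjective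
    have := Module.Projective.of_split (LinearMap.inl S M N) (LinearMap.fst S M N) (by ext; simp)
    exact zero M
  | succ n ih =>
    have := h.finite
    obtain ⟨m, p, hp⟩ := Module.Finite.exists_fin' S (M × N)
    let p₁ := LinearMap.fst S M N ∘ₗ p
    let p₂ := LinearMap.snd S M N ∘ₗ p
    have hp₁ : Function.Surjective p₁ := Prod.fst_surjective.comp hp
    have hp₂ : Function.Surjective p₂ := Prod.snd_surjective.comp hp
    refine succ p₁.ker.subtype p₁ p₁.ker.injective_subtype hp₁
      (LinearMap.exact_subtype_ker_map p₁) ?_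
    refine ih (N := p₂.ker) (h.syzygy (i := p₁.ker.subtype.prodMap p₂.ker.subtype)
      (p := p₁.prodMap p₂) ?_ (hp₁.prodMap hp₂) ?_)
    · exact p₁.ker.injective_subtype.prodMap p₂.ker.injective_subtype
    · rintro ⟨x, y⟩
      simp

lemma of_retract (h : HasFiniteResolution S n M) {i : N →ₗ[S] M} {r : M →ₗ[S] N}
    (hir : r ∘ₗ i = LinearMap.id) : HasFiniteResolution S n N := by
  have hr : Function.Surjective r := fun x ↦ ⟨i x, congr($hir x)⟩
  let e := ((LinearMap.exact_subtype_ker_map r).splitSurjectiveEquiv r.ker.injective_subtype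
    ⟨i, hir⟩).1
  exact (h.of_equiv (e ≪≫ₗ LinearEquiv.prodComm S _ _)).of_prod

end HasFiniteResolution

section IsPerfectModule

variable {S : Type u} [CommRing S]

lemma quasiIso_toSingle₀Equiv_symm {M : ModuleCat.{u} S} {P : ChainComplex (ModuleCat.{u} S) ℕ}
    (ε : P.X 0 ⟶ M) (h : P.d 1 0 ≫ ε = 0) (hε : Function.Surjective ε)
    (h₀ : Function.Exact (P.d 1 0) ε)
    (h₁ : ∀ n, Function.Exact (P.d (n + 2) (n + 1)) (P.d (n + 1) n)) :
    QuasiIso ((ChainComplex.toSingle₀Equiv P M).symm ⟨ε, h⟩) := by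
  refine ⟨fun n ↦ ?_⟩
  cases n with
  | zero =>
    rw [ChainComplex.quasiIsoAt₀_iff, ShortComplex.quasiIso_iff_of_zeros']
    · refine (ShortComplex.exact_and_epi_g_iff_of_iso
        (S₁ := ShortComplex.mk _ _ h) ?_).1 ⟨?_, ?_⟩
      · exact ShortComplex.isoMk (Iso.refl _) (Iso.refl _) (Iso.refl _) (by simp; rfl) (by simp; rfl)
      · exact (ShortComplex.ShortExact.moduleCat_exact_iff_function_exact _).2 h₀
      · exact (ModuleCat.epi_iff_surjective _).2 hε
    · exact P.shape _ _ (by simp)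
    all_goals rfl
  | succ n =>
    rw [quasiIsoAt_iff_exactAt']
    · rw [HomologicalComplex.exactAt_iff' _ (n + 1 + 1) (n + 1) n (by simp) (by simp)]
      exact (ShortComplex.ShortExact.moduleCat_exact_iff_function_exact _).2 (h₁ n)
    · apply ChainComplex.exactAt_succ_single_obj

lemma HasFiniteResolution.exists_chainComplex {n : ℕ} {M : Type u} [AddCommGroup M] [Module S M]
    (h : HasFiniteResolution S n M) :
    ∃ (P : ChainComplex (ModuleCat.{u} S) ℕ) (ε : P.X 0 ⟶ ModuleCat.of S M),
      (∀ i, Module.Finite S (P.X i)) ∧ (∀ i, Module.Projective S (P.X i)) ∧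
      (∃ n : ℕ, ∀ i, n ≤ i → IsZero (P.X i)) ∧ Function.Surjective ε ∧
      Function.Exact (P.d 1 0) ε ∧
      ∀ n, Function.Exact (P.d (n + 2) (n + 1)) (P.d (n + 1) n) := by
  induction h with
  | zero M =>
    let Z : ChainComplex (ModuleCat.{u} S) ℕ :=
      { X _ := ModuleCat.of S PUnit.{u + 1}, d _ _ := 0 }
    have hZ (i) : Subsingleton (Z.X i) := inferInstanceAs (Subsingleton PUnit.{u + 1})
    refine ⟨Z.augment (X := ModuleCat.of S M) 0 comp_zero, 𝟙 (ModuleCat.of S M), ?_, ?_, ⟨1, ?_⟩,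
      Function.surjective_id, ?_, ?_⟩
    · rintro (_ | i)
      · exact ‹Module.Finite S M›
      · exact Module.Finite.of_finite (M := Z.X i)
    · rintro (_ | i)
      · exact ‹Module.Projective S M›
      · exact inferInstanceAs (Module.Projective S PUnit.{u + 1})
    · rintro (_ | i) hi
      · omega
      · exact ModuleCat.isZero_of_subsingleton (Z.X i)
    · exact fun x ↦ ⟨fun h ↦ ⟨0, h.symm⟩, fun ⟨_, h⟩ ↦ h.symm⟩
    · rintro n x
      exact ⟨fun _ ↦ ⟨0, Subsingleton.elim (α := Z.X n) _ _⟩, fun _ ↦ by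
        cases n <;> rfl⟩
  | @succ n K F M _ _ _ _ _ _ _ _ i p hi hp hip hK ih =>
    obtain ⟨P, ε, hf, hpr, ⟨m, hm⟩, hε, h₀, h₁⟩ := ih
    refine ⟨P.augment (ε ≫ ModuleCat.ofHom i) ?_, ModuleCat.ofHom p, ?_, ?_, ⟨m + 1, ?_⟩, hp,
      ?_, ?_⟩
    · ext x
      exact (congrArg i (h₀.apply_apply_eq_zero x)).trans (map_zero i)
    · rintro (_ | i)
      · exact ‹Module.Finite S F›
      · exact hf i
    · rintro (_ | i)
      · exact ‹Module.Projective S F›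
      · exact hpr i
    · rintro (_ | i) hi
      · omega
      · exact hm i (by omega)
    · intro x
      refine (hip x).trans ⟨?_, ?_⟩
      · rintro ⟨y, rfl⟩
        obtain ⟨z, rfl⟩ := hε y
        exact ⟨z, rfl⟩
      · rintro ⟨z, rfl⟩
        exact ⟨ε z, rfl⟩
    · rintro (_ | n)
      · exact fun x ↦ ((map_eq_zero_iff i hi).trans (h₀ x))
      · exact h₁ n

lemma HasFiniteResolution.isPerfectModule {n : ℕ} {M : Type u} [AddCommGroup M] [Module S M]
    (h : HasFiniteResolution S n M) : IsPerfectModule S (ModuleCat.of S M) := by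
  obtain ⟨P, ε, hf, hpr, hm, hε, h₀, h₁⟩ := h.exists_chainComplex
  refine ⟨P, (ChainComplex.toSingle₀Equiv P _).symm ⟨ε, ?_⟩, hf, hpr, hm,
    quasiIso_toSingle₀Equiv_symm ε _ hε h₀ h₁⟩
  ext x
  exact h₀.apply_apply_eq_zero x

end IsPerfectModule

/-- `M` has a resolution of length `n` by finitely generated projective modules after localizing
away from `r`. -/
def HasFiniteResolutionAway {S : Type u} [CommRing S] (r : S) (n : ℕ) (M : Type u)
    [AddCommGroup M] [Module S M] : Prop :=
  ∃ (Sr : Type u) (_ : CommRing Sr) (_ : Algebra S Sr) (_ : IsLocalization.Away r Sr)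
    (Mr : Type u) (_ : AddCommGroup Mr) (_ : Module S Mr) (_ : Module Sr Mr)
    (_ : IsScalarTower S Sr Mr) (f : M →ₗ[S] Mr), IsLocalizedModule (Submonoid.powers r) f ∧
      HasFiniteResolution Sr n Mr

section Local

variable {S : Type u} [CommRing S] {n : ℕ} {M : Type u} [AddCommGroup M] [Module S M]

lemma HasFiniteResolutionAway.mono {r : S} {m : ℕ} (h : HasFiniteResolutionAway r n M)
    (hnm : n ≤ m) : HasFiniteResolutionAway r m M := by
  obtain ⟨Sr, _, _, _, Mr, _, _, _, _, f, hf, h⟩ := h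
  exact ⟨Sr, _, _, ‹_›, Mr, _, _, _, ‹_›, f, hf, h.mono hnm⟩

lemma HasFiniteResolutionAway.ker {r : S} {F : Type u} [AddCommGroup F] [Module S F]
    [Module.Finite S F] [Module.Projective S F] (h : HasFiniteResolutionAway r (n + 1) M)
    (p : F →ₗ[S] M) (hp : Function.Surjective p) : HasFiniteResolutionAway r n p.ker := by
  obtain ⟨Sr, _, _, _, Mr, _, _, _, _, f, hf, h⟩ := h
  let g : F →ₗ[S] Sr ⊗[S] F := TensorProduct.mk S Sr F 1
  let q := (IsLocalizedModule.map (Submonoid.powers r) g f p).extendScalarsOfIsLocalization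
    (Submonoid.powers r) Sr
  let e : p.ker.localized' Sr (Submonoid.powers r) g ≃ₗ[Sr] q.ker :=
    LinearEquiv.ofEq _ _ (LinearMap.localized'_ker_eq_ker_localizedMap Sr (.powers r) g f p)
  refine ⟨Sr, _, _, ‹_›, p.ker.localized' Sr (.powers r) g,
    Submodule.addCommGroup _, Submodule.module' _, Submodule.module _,
    inferInstance, p.ker.toLocalized' Sr (.powers r) g, inferInstance, ?_⟩
  have hq : HasFiniteResolution Sr n q.ker := by
    refine h.syzygy q.ker.injective_subtype ?_ (LinearMap.exact_subtype_ker_map q)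
    exact IsLocalizedModule.map_surjective (Submonoid.powers r) g f p hp
  exact hq.of_equiv e.symm

lemma finite_of_hasFiniteResolutionAway (s : Set S) (hs : Ideal.span s = ⊤)
    (h : ∀ r ∈ s, HasFiniteResolutionAway r n M) : Module.Finite S M := by
  choose Sr _ _ _ Mr _ _ _ _ f _ hM using h
  exact Module.Finite.of_localizationSpan' s hs (Rₚ := fun r ↦ Sr r r.2) (Mₚ := fun r ↦ Mr r r.2)
    (fun r ↦ f r r.2) fun r ↦ (hM r r.2).finite

lemma hasFiniteResolution_zero_of_away (s : Set S) (hs : Ideal.span s = ⊤)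
    (h : ∀ r ∈ s, HasFiniteResolutionAway r 0 M) : HasFiniteResolution S 0 M := by
  have := finite_of_hasFiniteResolutionAway s hs h
  choose Sr _ _ _ Mr _ _ _ _ f _ hM using h
  have hfin (r) (hr : r ∈ s) := (hM r hr).finite_projective.1
  have hproj (r) (hr : r ∈ s) := (hM r hr).finite_projective.2
  have : Module.FinitePresentation S M :=
    Module.FinitePresentation.of_localizationSpan' s hs (Rₚ := fun r ↦ Sr r r.2)
      (Mₚ := fun r ↦ Mr r r.2) (fun r ↦ f r r.2) fun r ↦
      have := hfin r r.2
      have := hproj r r.2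
      Module.finitePresentation_of_projective _ _
  have : Module.Flat S M :=
    Module.flat_of_isLocalized_span S M s hs (fun r ↦ Mr r r.2) (fun r ↦ f r r.2) fun r ↦
      have := hproj r r.2
      have := IsLocalization.flat (Sr r r.2) (Submonoid.powers r.1)
      Module.Flat.trans S (Sr r r.2) (Mr r r.2)
  have := Module.Flat.projective_of_finitePresentation (R := S) (M := M)
  exact .zero M

/-- Having a resolution of length `n` by finitely generated projective modules is a local
property. -/
lemma hasFiniteResolution_of_away (s : Set S) (hs : Ideal.span s = ⊤)
    (h : ∀ r ∈ s, HasFiniteResolutionAway r n M) : HasFiniteResolution S n M := by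
  induction n generalizing M with
  | zero => exact hasFiniteResolution_zero_of_away s hs h
  | succ n ih =>
    have := finite_of_hasFiniteResolutionAway s hs h
    obtain ⟨m, p, hp⟩ := Module.Finite.exists_fin' S M
    exact .succ p.ker.subtype p p.ker.injective_subtype hp (LinearMap.exact_subtype_ker_map p)
      (ih fun r hr ↦ (h r hr).ker p hp)

end Local

section Regular

open Pointwise RingTheory.Sequence

lemma HasFiniteResolution.quotient_of_isWeaklyRegular {S : Type u} [CommRing S] {n : ℕ}
    {M : Type u} [AddCommGroup M] [Module S M] {rs : List S} (h : HasFiniteResolution S n M)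
    (hrs : IsWeaklyRegular M rs) :
    HasFiniteResolution S (n + rs.length) (M ⧸ (Ideal.ofList rs • ⊤ : Submodule S M)) := by
  induction rs generalizing n M with
  | nil => exact h.of_equiv (Submodule.quotEquivOfEqBot _ (by simp)).symm
  | cons r rs ih =>
    rw [isWeaklyRegular_cons_iff] at hrs
    have h' : HasFiniteResolution S (n + 1) (QuotSMulTop r M) :=
      h.of_injective h (i := LinearMap.lsmul S M r) (p := (r • (⊤ : Submodule S M)).mkQ) hrs.1
        (Submodule.mkQ_surjective _) (LinearMap.exact_lsmul_mkQ_smul_top M r)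
    have := (ih h' hrs.2).of_equiv
      (Submodule.quotOfListConsSMulTopEquivQuotSMulTopInner M r rs).symm
    rwa [add_right_comm] at this

open Polynomial in
/-- Dividing the polynomial ring by `X - c` gives back the coefficient ring. -/
lemma exists_quotSMulTop_X_sub_C_addEquiv {Q : Type*} [CommRing Q] (c : Q) :
    ∃ e : QuotSMulTop (X - C c) Q[X] ≃+ Q,
      ∀ (q : Q) x, e (C q • x) = q • e x := by
  let _ : Module Q[X] Q := Module.compHom Q (evalRingHom c)
  let f : Q[X] →ₗ[Q[X]] Q :=
    { toFun := eval c, map_add' := fun _ _ ↦ eval_add, map_smul' := fun _ _ ↦ eval_mul }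
  have hf : Function.Surjective f := fun q ↦ ⟨C q, eval_C⟩
  have hker : (X - C c) • (⊤ : Submodule Q[X] Q[X]) = f.ker := by
    ext p
    rw [← Submodule.ideal_span_singleton_smul, smul_eq_mul, Ideal.mul_top,
      Ideal.mem_span_singleton]
    exact dvd_iff_isRoot
  refine ⟨((Submodule.quotEquivOfEq _ _ hker).trans (f.quotKerEquivOfSurjective hf)).toAddEquiv,
    fun q x ↦ ?_⟩
  refine (((Submodule.quotEquivOfEq _ _ hker).trans
    (f.quotKerEquivOfSurjective hf)).map_smul (C q) x).trans ?_
  exact congrArg (· * _) eval_C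

lemma isWeaklyRegular_self_map_ringEquiv {R R' : Type*} [CommRing R] [CommRing R'] (e : R ≃+* R')
    (rs : List R) : IsWeaklyRegular R rs ↔ IsWeaklyRegular R' (rs.map e) :=
  AddEquiv.isWeaklyRegular_congr (e := e.toAddEquiv) <| List.forall₂_map_right_iff.mpr <|
    List.forall₂_same.mpr fun r _ x ↦ e.map_mul r x

lemma isWeaklyRegular_map_algebraMap_of_addEquiv {Q S M : Type*} [CommRing Q] [CommRing S]
    [AddCommGroup M] [Module S M] (f : Q →+* S) (e : M ≃+ Q) (he : ∀ (q : Q) x, e (f q • x) = q • e x)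
    {rs : List Q} (h : IsWeaklyRegular Q rs) : IsWeaklyRegular M (rs.map f) :=
  (AddEquiv.isWeaklyRegular_congr (e := e) <| List.forall₂_map_left_iff.mpr <|
    List.forall₂_same.mpr fun r _ x ↦ he r x).2 h

open MvPolynomial in
lemma isWeaklyRegular_X_sub_C {R : Type*} [CommRing R] {d : ℕ} (a : Fin d → R) :
    IsWeaklyRegular (MvPolynomial (Fin d) R) (List.ofFn fun i ↦ X i - C (a i)) := by
  induction d with
  | zero => simp
  | succ d ih =>
    let c : MvPolynomial (Fin d) R := C (a 0)
    have hC (r : R) : finSuccEquiv R d (C r) = Polynomial.C (C r) := by simp [finSuccEquiv_apply]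
    have hrs : (List.ofFn fun i ↦ X i - C (a i)).map (finSuccEquiv R d) =
        (Polynomial.X - Polynomial.C c) ::
          (List.ofFn fun i ↦ X i - C (a i.succ)).map Polynomial.C := by
      simp [List.ofFn_succ, List.map_ofFn, Function.comp_def, hC, finSuccEquiv_X_zero,
        finSuccEquiv_X_succ, c]
    refine (isWeaklyRegular_self_map_ringEquiv (finSuccEquiv R d).toRingEquiv _).2 ?_
    refine hrs ▸ (isWeaklyRegular_cons_iff _ _ _).2
      ⟨(Polynomial.monic_X_sub_C c).isRegular.left, ?_⟩
    obtain ⟨e, he⟩ := exists_quotSMulTop_X_sub_C_addEquiv c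
    exact isWeaklyRegular_map_algebraMap_of_addEquiv _ e he (ih _)

end Regular

section Diagonal

variable {k A}

/-- If `A` is unramified over `B`, then modulo `I ^ 2` the diagonal ideal `I` of `A ⊗[k] A` is
generated by the elements coming from `B`. -/
lemma ideal_le_sup_of_formallyUnramified {B : Type u} [CommRing B] [Algebra k B] {f : B →ₐ[k] A}
    (hf : f.FormallyUnramified) {T : Ideal (A ⊗[k] A)}
    (hT : ∀ b, (1 : A) ⊗ₜ[k] f b - f b ⊗ₜ[k] (1 : A) ∈ T) :
    KaehlerDifferential.ideal k A ≤
      T ⊔ KaehlerDifferential.ideal k A • KaehlerDifferential.ideal k A := by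
  let I := KaehlerDifferential.ideal k A
  let J : Ideal (A ⊗[k] A) := T ⊔ I • I
  let _ : Algebra B A := f.toRingHom.toAlgebra
  have : Algebra.FormallyUnramified B A := hf
  let l : A →+* (A ⊗[k] A) ⧸ J := (Ideal.Quotient.mk J).comp Algebra.TensorProduct.includeLeftRingHom
  let r : A →+* (A ⊗[k] A) ⧸ J :=
    (Ideal.Quotient.mk J).comp (Algebra.TensorProduct.includeRight (R := k) (A := A)).toRingHom
  let _ : Algebra B ((A ⊗[k] A) ⧸ J) := (l.comp f.toRingHom).toAlgebra
  let g₁ : A →ₐ[B] (A ⊗[k] A) ⧸ J := { l with commutes' := fun _ ↦ rfl }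
  let g₂ : A →ₐ[B] (A ⊗[k] A) ⧸ J :=
    { r with commutes' := fun b ↦ Ideal.Quotient.eq.2 (Ideal.mem_sup_left (hT b)) }
  have hnil : IsNilpotent (I.map (Ideal.Quotient.mk J)) := by
    refine ⟨2, ?_⟩
    rw [← Ideal.map_pow, Ideal.zero_eq_bot, Ideal.map_eq_bot_iff_le_ker, Ideal.mk_ker, pow_two]
    exact le_sup_right
  have hg : g₁ = g₂ := Algebra.FormallyUnramified.ext _ hnil fun a ↦ by
    refine (Ideal.Quotient.eq.2 ?_).symm
    have := KaehlerDifferential.one_smul_sub_smul_one_mem_ideal k a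
    exact (map_sub (Ideal.Quotient.mk J) _ _).symm ▸ Ideal.mem_map_of_mem (Ideal.Quotient.mk J) this
  refine (KaehlerDifferential.span_range_eq_ideal k A).symm.le.trans (Ideal.span_le.2 ?_)
  rintro _ ⟨a, rfl⟩
  exact Ideal.Quotient.eq.1 congr($hg a).symm

lemma one_tmul_sub_mem_span {d : ℕ} (f : MvPolynomial (Fin d) k →ₐ[k] A)
    (b : MvPolynomial (Fin d) k) :
    (1 : A) ⊗ₜ[k] f b - f b ⊗ₜ[k] (1 : A) ∈ Ideal.ofList
      (List.ofFn fun i ↦ (1 : A) ⊗ₜ[k] f (.X i) - f (.X i) ⊗ₜ[k] (1 : A)) := by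
  set T := Ideal.ofList (List.ofFn fun i ↦ (1 : A) ⊗ₜ[k] f (.X i) - f (.X i) ⊗ₜ[k] (1 : A))
  have hT (i) : (1 : A) ⊗ₜ[k] f (.X i) - f (.X i) ⊗ₜ[k] (1 : A) ∈ T :=
    Ideal.subset_span (List.mem_ofFn.2 ⟨i, rfl⟩)
  let φ₁ := ((Ideal.Quotient.mkₐ k T).comp Algebra.TensorProduct.includeRight).comp f
  let φ₂ := ((Ideal.Quotient.mkₐ k T).comp
    (Algebra.TensorProduct.includeLeft (R := k) (S := k) (B := A))).comp f
  have : φ₁ = φ₂ := MvPolynomial.algHom_ext fun i ↦ Ideal.Quotient.eq.2 (hT i)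
  exact Ideal.Quotient.eq.1 congr($this b)

open RingTheory.Sequence in
lemma isWeaklyRegular_one_tmul_sub {d : ℕ} {f : MvPolynomial (Fin d) k →ₐ[k] A} (hf : f.Flat) :
    IsWeaklyRegular (A ⊗[k] A)
      (List.ofFn fun i ↦ (1 : A) ⊗ₜ[k] f (.X i) - f (.X i) ⊗ₜ[k] (1 : A)) := by
  let φ : MvPolynomial (Fin d) A →ₐ[A] A ⊗[k] A :=
    (Algebra.TensorProduct.map (AlgHom.id A A) f).comp
      (MvPolynomial.algebraTensorAlgEquiv k A).symm.toAlgHom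
  have hφ : φ.toRingHom.Flat := RingHom.Flat.comp
    (.of_bijective (MvPolynomial.algebraTensorAlgEquiv k A).symm.bijective)
    (RingHom.Flat.tensorProductMap (.id A) hf)
  let _ := φ.toRingHom.toAlgebra
  have : Module.Flat (MvPolynomial (Fin d) A) (A ⊗[k] A) := hφ
  have h := IsWeaklyRegular.of_flat (S := A ⊗[k] A) (isWeaklyRegular_X_sub_C fun i ↦ f (.X i))
  have hφX (i) : φ (.X i - .C (f (.X i))) = (1 : A) ⊗ₜ[k] f (.X i) - f (.X i) ⊗ₜ[k] (1 : A) := by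
    have : φ (.C (f (.X i))) = f (.X i) ⊗ₜ[k] (1 : A) := φ.commutes _
    rw [map_sub, this]
    simp [φ, MvPolynomial.algebraTensorAlgEquiv_symm_X]
  have hlist : (List.ofFn fun i ↦ (.X i - .C (f (.X i)) : MvPolynomial (Fin d) A)).map φ =
      List.ofFn fun i ↦ (1 : A) ⊗ₜ[k] f (.X i) - f (.X i) ⊗ₜ[k] (1 : A) := by
    rw [List.map_ofFn]
    exact congrArg _ (funext hφX)
  exact hlist ▸ h

lemma hasFiniteResolution_quotient_ideal {d : ℕ} {f : MvPolynomial (Fin d) k →ₐ[k] A}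
    (hf : f.Etale) :
    HasFiniteResolution (A ⊗[k] A) d ((A ⊗[k] A) ⧸ KaehlerDifferential.ideal k A) := by
  set I := KaehlerDifferential.ideal k A with hI
  set rs := List.ofFn fun i ↦ (1 : A) ⊗ₜ[k] f (.X i) - f (.X i) ⊗ₜ[k] (1 : A)
  have hflat : f.Flat := (RingHom.Etale.iff_flat_and_formallyUnramified.1 hf).1
  have hunr : f.FormallyUnramified := hf.formallyUnramified
  have hrs := (HasFiniteResolution.of_projective (S := A ⊗[k] A) (M := A ⊗[k] A) 0
    ).quotient_of_isWeaklyRegular (isWeaklyRegular_one_tmul_sub hflat)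
  rw [List.length_ofFn, zero_add, smul_eq_mul, Ideal.mul_top] at hrs
  have hrsI : Ideal.ofList rs ≤ I := by
    rw [Ideal.ofList, Ideal.span_le]
    intro x hx
    obtain ⟨i, rfl⟩ := List.mem_ofFn.1 hx
    exact KaehlerDifferential.one_smul_sub_smul_one_mem_ideal k _
  have : Algebra.FiniteType k A := by
    have := (RingHom.FiniteType.of_finitePresentation
      (RingHom.Etale.iff_flat_and_formallyUnramified.1 hf).2.2).comp
      (f := algebraMap k (MvPolynomial (Fin d) k)) (RingHom.finiteType_algebraMap.2 inferInstance)
    have hcomp : f.toRingHom.comp (algebraMap k (MvPolynomial (Fin d) k)) = algebraMap k A :=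
      f.comp_algebraMap
    rwa [hcomp, RingHom.finiteType_algebraMap] at this
  have hfg : I.FG := KaehlerDifferential.ideal_fg k A
  obtain ⟨r, hr, hrI⟩ := Submodule.exists_sub_one_mem_and_smul_le_of_fg_of_le_sup hfg le_rfl
    (ideal_le_sup_of_formallyUnramified hunr (one_tmul_sub_mem_span f))
  refine hrs.of_retract (i := Submodule.mapQ I (Ideal.ofList rs) (LinearMap.lsmul _ _ r) ?_)
    (r := Submodule.factor hrsI) ?_
  · exact fun x hx ↦ hrI (Submodule.smul_mem_pointwise_smul x r _ hx)
  · refine LinearMap.ext fun x ↦ ?_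
    obtain ⟨x, rfl⟩ := Submodule.mkQ_surjective _ x
    refine (Submodule.Quotient.eq I).2 ?_
    have := I.mul_mem_right x hr
    rwa [sub_mul, one_mul] at this

end Diagonal

section Globalization

variable {k A}
variable {B : Type u} [CommRing B] [Algebra k B] [Algebra A B] [IsScalarTower k A B]

lemma isLocalizationAway_tmul_self (g : A) [IsLocalization.Away g B] :
    let _ : Algebra (A ⊗[k] A) (B ⊗[k] B) := (Algebra.TensorProduct.map
      (IsScalarTower.toAlgHom k A B) (IsScalarTower.toAlgHom k A B)).toRingHom.toAlgebra
    IsLocalization.Away (g ⊗ₜ[k] g : A ⊗[k] A) (B ⊗[k] B) := by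
  intro _
  let ι := IsScalarTower.toAlgHom k A B
  let _ : Algebra (A ⊗[k] A) (B ⊗[k] A) :=
    (Algebra.TensorProduct.map ι (AlgHom.id k A)).toRingHom.toAlgebra
  let _ : Algebra (B ⊗[k] A) (B ⊗[k] B) :=
    (Algebra.TensorProduct.map (AlgHom.id k B) ι).toRingHom.toAlgebra
  have hA (a b : A) : algebraMap (A ⊗[k] A) (B ⊗[k] A) (a ⊗ₜ b) = algebraMap A B a ⊗ₜ b := rfl
  have hB (a : B) (b : A) :
    algebraMap (B ⊗[k] A) (B ⊗[k] B) (a ⊗ₜ b) = a ⊗ₜ algebraMap A B b := rfl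
  have : IsScalarTower (A ⊗[k] A) (B ⊗[k] A) (B ⊗[k] B) := by
    refine .of_algebraMap_eq fun x ↦ ?_
    induction x with
    | zero => simp
    | add x y hx hy => simp only [map_add, hx, hy]
    | tmul a b => rfl
  have : IsScalarTower A (A ⊗[k] A) (B ⊗[k] A) := .of_algebraMap_eq fun x ↦ rfl
  have : IsScalarTower B (B ⊗[k] A) (B ⊗[k] B) := .of_algebraMap_eq fun x ↦ by
    exact (congrArg _ (map_one (algebraMap A B)).symm : x ⊗ₜ[k] (1 : B) = _)
  have h₁ : IsLocalization.Away (g ⊗ₜ[k] (1 : A)) (B ⊗[k] A) := by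
    have := IsLocalization.tensorProduct_tensorProduct k A (.powers g) B
      (RingHom.ext fun a ↦ by
        exact (congrArg (· ⊗ₜ[k] a) (map_one (algebraMap A B)) :))
    rwa [Algebra.algebraMapSubmonoid_powers] at this
  have h₂ : IsLocalization.Away ((1 : B) ⊗ₜ[k] g) (B ⊗[k] B) := by
    have := IsLocalization.tensorProduct_tensorProduct_right k B (.powers g) B
      (RingHom.ext fun a ↦ rfl)
    rwa [Submonoid.map_powers] at this
  have h₃ : IsLocalization.Away (algebraMap (A ⊗[k] A) (B ⊗[k] A) (1 ⊗ₜ[k] g)) (B ⊗[k] B) := by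
    rwa [hA, map_one]
  have := IsLocalization.Away.mul' (B ⊗[k] A) (B ⊗[k] B) (g ⊗ₜ[k] (1 : A)) (1 ⊗ₜ[k] g)
  rwa [Algebra.TensorProduct.tmul_mul_tmul, mul_one, one_mul] at this

lemma map_ideal_eq_of_isLocalization (M : Submonoid A) [IsLocalization M B] :
    (KaehlerDifferential.ideal k A).map (Algebra.TensorProduct.map
      (IsScalarTower.toAlgHom k A B) (IsScalarTower.toAlgHom k A B)) =
    KaehlerDifferential.ideal k B := by
  set m := Algebra.TensorProduct.map (IsScalarTower.toAlgHom k A B) (IsScalarTower.toAlgHom k A B)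
  have hm (a : A) : m ((1 : A) ⊗ₜ[k] a - a ⊗ₜ[k] (1 : A)) =
      (1 : B) ⊗ₜ[k] algebraMap A B a - algebraMap A B a ⊗ₜ[k] (1 : B) := by
    simp [m]
  apply le_antisymm
  · rw [← KaehlerDifferential.span_range_eq_ideal k A, Ideal.map_span, Ideal.span_le]
    rintro _ ⟨_, ⟨a, rfl⟩, rfl⟩
    exact hm a ▸ KaehlerDifferential.one_smul_sub_smul_one_mem_ideal k _
  · rw [← KaehlerDifferential.span_range_eq_ideal k B, Ideal.span_le]
    set Q := (KaehlerDifferential.ideal k A).map m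
    let l : B →+* (B ⊗[k] B) ⧸ Q :=
      (Ideal.Quotient.mk Q).comp Algebra.TensorProduct.includeLeftRingHom
    let r : B →+* (B ⊗[k] B) ⧸ Q :=
      (Ideal.Quotient.mk Q).comp (Algebra.TensorProduct.includeRight (R := k) (A := B)).toRingHom
    have hlr : r = l := IsLocalization.ringHom_ext M <| RingHom.ext fun a ↦ by
      refine Ideal.Quotient.eq.2 (?_ : (1 : B) ⊗ₜ[k] algebraMap A B a -
        algebraMap A B a ⊗ₜ[k] (1 : B) ∈ Q)
      exact hm a ▸ Ideal.mem_map_of_mem m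
        (KaehlerDifferential.one_smul_sub_smul_one_mem_ideal k a)
    rintro _ ⟨b, rfl⟩
    exact Ideal.Quotient.eq.1 congr($hlr b)

lemma hasFiniteResolutionAway_tmul_self {n : ℕ} (g : A) [IsLocalization.Away g B]
    (h : HasFiniteResolution (B ⊗[k] B) n ((B ⊗[k] B) ⧸ KaehlerDifferential.ideal k B)) :
    HasFiniteResolutionAway (g ⊗ₜ[k] g : A ⊗[k] A) n
      ((A ⊗[k] A) ⧸ KaehlerDifferential.ideal k A) := by
  let _ : Algebra (A ⊗[k] A) (B ⊗[k] B) := (Algebra.TensorProduct.map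
    (IsScalarTower.toAlgHom k A B) (IsScalarTower.toAlgHom k A B)).toRingHom.toAlgebra
  have : IsLocalization.Away (g ⊗ₜ[k] g : A ⊗[k] A) (B ⊗[k] B) := isLocalizationAway_tmul_self g
  let M := Submonoid.powers (g ⊗ₜ[k] g : A ⊗[k] A)
  let I := KaehlerDifferential.ideal k A
  have hI : Submodule.localized' (B ⊗[k] B) M (Algebra.linearMap (A ⊗[k] A) (B ⊗[k] B)) I =
      KaehlerDifferential.ideal k B :=
    (Ideal.localized'_eq_map ..).trans (map_ideal_eq_of_isLocalization (.powers g))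
  refine ⟨B ⊗[k] B, inferInstance, inferInstance, this, _, _, _, _, inferInstance,
    Submodule.toLocalizedQuotient' (B ⊗[k] B) M (Algebra.linearMap (A ⊗[k] A) (B ⊗[k] B)) I,
    inferInstance, ?_⟩
  exact h.of_equiv (Submodule.quotEquivOfEq _ _ hI.symm)

lemma hasFiniteResolutionAway_of_mem {S : Type u} [CommRing S] {I : Ideal S} {r : S} (hr : r ∈ I)
    (n : ℕ) : HasFiniteResolutionAway r n (S ⧸ I) := by
  refine ⟨Localization.Away r, inferInstance, inferInstance, inferInstance,
    LocalizedModule (.powers r) (S ⧸ I), inferInstance, inferInstance, inferInstance,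
    inferInstance, LocalizedModule.mkLinearMap _ _, inferInstance, ?_⟩
  have : Subsingleton (LocalizedModule (.powers r) (S ⧸ I)) := by
    refine LocalizedModule.subsingleton_iff.2 fun m ↦ ⟨r, Submonoid.mem_powers r, ?_⟩
    obtain ⟨m, rfl⟩ := Ideal.Quotient.mk_surjective m
    exact Ideal.Quotient.eq_zero_iff_mem.2 (I.mul_mem_right m hr)
  exact .of_subsingleton n

lemma exists_hasFiniteResolution_of_isStandardSmooth [Algebra.IsStandardSmooth k B] :
    ∃ n, HasFiniteResolution (B ⊗[k] B) n ((B ⊗[k] B) ⧸ KaehlerDifferential.ideal k B) := by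
  obtain ⟨n, φ, hφC, hφ⟩ := RingHom.IsStandardSmooth.exists_etale_mvPolynomial
    (f := algebraMap k B) (by simpa [RingHom.isStandardSmooth_algebraMap])
  let f : MvPolynomial (Fin n) k →ₐ[k] B := { φ with commutes' := fun a ↦ congr($hφC a) }
  exact ⟨n, hasFiniteResolution_quotient_ideal (f := f) hφ⟩

/-- The elements `g ⊗ g`, for `g` ranging over a cover of `Spec A`, cover the diagonal. -/
lemma span_tmul_self_union_ideal_eq_top {s : Set A} (hs : Ideal.span s = ⊤) :
    Ideal.span ((fun g ↦ g ⊗ₜ[k] g) '' s ∪ (KaehlerDifferential.ideal k A : Set (A ⊗[k] A))) =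
      ⊤ := by
  let μ := (Algebra.TensorProduct.lmul' k (S := A)).toRingHom
  have hμ : Function.Surjective μ := fun a ↦ ⟨a ⊗ₜ 1, by simp [μ]⟩
  have hsq : Ideal.span ((· ^ 2) '' s) = ⊤ := Ideal.span_pow_eq_top s hs 2
  rw [Ideal.span_union, Ideal.span_eq]
  have h : (Ideal.span ((fun g ↦ g ⊗ₜ[k] g) '' s)).map μ = ⊤ := by
    rw [Ideal.map_span, Set.image_image, ← hsq]
    refine congrArg _ (Set.image_congr fun g _ ↦ ?_)
    simp [μ, pow_two]
  have h' := congrArg (Ideal.comap μ) h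
  rwa [Ideal.comap_map_of_surjective μ hμ, Ideal.comap_top] at h'

variable (k A) in
lemma exists_hasFiniteResolution_of_smooth [Algebra.Smooth k A] :
    ∃ n, HasFiniteResolution (A ⊗[k] A) n ((A ⊗[k] A) ⧸ KaehlerDifferential.ideal k A) := by
  obtain ⟨s, hs, hsm⟩ := Algebra.Smooth.exists_span_eq_top_isStandardSmooth k A
  obtain ⟨t, hts, ht⟩ := (Ideal.span_eq_top_iff_finite s).1 hs
  have h (g : A) (hg : g ∈ t) : ∃ n, HasFiniteResolutionAway (g ⊗ₜ[k] g : A ⊗[k] A) n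
      ((A ⊗[k] A) ⧸ KaehlerDifferential.ideal k A) := by
    have := hsm g (hts hg)
    obtain ⟨n, hn⟩ := exists_hasFiniteResolution_of_isStandardSmooth
      (k := k) (B := Localization.Away g)
    exact ⟨n, hasFiniteResolutionAway_tmul_self g hn⟩
  choose! n hn using h
  refine ⟨t.sup n, hasFiniteResolution_of_away _ (span_tmul_self_union_ideal_eq_top ht) ?_⟩
  rintro _ (⟨g, hg, rfl⟩ | hr)
  · exact (hn g hg).mono (Finset.le_sup hg)
  · exact hasFiniteResolutionAway_of_mem hr _

end Globalization

lemma ker_mulMap : RingHom.ker (mulMap k A).toRingHom = KaehlerDifferential.ideal k A := by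
  have : mulMap k A = Algebra.TensorProduct.lmul' k := by
    ext <;> simp [mulMap]
  rw [this]
  rfl

theorem stmt14 [Algebra.Smooth k A] :
    letI : Module (A ⊗[k] A) A := Module.compHom A (mulMap k A).toRingHom
    IsPerfectModule (A ⊗[k] A)
        (ModuleCat.of (A ⊗[k] A) (RingHom.ker (mulMap k A).toRingHom)) ∧
      IsPerfectModule (A ⊗[k] A) (ModuleCat.of (A ⊗[k] A) A) := by
  obtain ⟨n, hn⟩ := exists_hasFiniteResolution_of_smooth k A
  rw [← ker_mulMap] at hn
  let _ : Module (A ⊗[k] A) A := Module.compHom A (mulMap k A).toRingHom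
  let p : A ⊗[k] A →ₗ[A ⊗[k] A] A :=
    { (mulMap k A).toRingHom with map_smul' := map_mul (mulMap k A) }
  have hp : Function.Surjective p := fun a ↦ ⟨a ⊗ₜ 1, by simp [p, mulMap]⟩
  let I := RingHom.ker (mulMap k A).toRingHom
  refine ⟨((hn.mono n.le_succ).syzygy I.subtype_injective I.mkQ_surjective
    (LinearMap.exact_subtype_mkQ I)).isPerfectModule, ?_⟩
  exact (hn.of_equiv (p.quotKerEquivOfSurjective hp)).isPerfectModule

end Stmt14
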